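/- If E is a closed subspace of the Hardy space H² that contains h_k for every k ≥ 2 and is invariant under the shift operator S (where (Sf)(ω) = ω·f(ω)), then E = H². -/

import Mathlib

open MeasureTheory Complex

noncomputable section

/-- Normalized Lebesgue (arc-length) measure on the unit circle, as a measure on `ℂ`. -/
def mCirc : Measure ℂ :=
  (ENNReal.ofReal (2 * Real.pi))⁻¹ •
    Measure.map (fun θ : ℝ => Complex.exp (θ * Complex.I))
      (volume.restrict (Set.Ioc 0 (2 * Real.pi)))

/-- `g_k(z) = Log(1 - z^k) - Log(1 - z) - log k`. -/
def gFun (k : ℕ) (z : ℂ) : ℂ :=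
  Complex.log (1 - z ^ k) - Complex.log (1 - z) - (Real.log k : ℂ)

/-- `h_k(z) = g_k(z) / (1 - z)`. -/
def hFun (k : ℕ) (z : ℂ) : ℂ := gFun k z / (1 - z)

/-- The Hardy space `H²`, viewed as the set of elements of `L²(𝕋, m)` whose negative
Fourier coefficients vanish. -/
def H2 : Set (Lp ℂ 2 mCirc) :=
  {f | ∀ n : ℤ, n < 0 → (∫ ω : ℂ, f ω * ω ^ (-n) ∂mCirc) = 0}

end

open Filter Topology Set Metric

section ShiftInvariant

/-- The a.e. class of `f` is represented by an element of the subspace `E`. -/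
def Submodule.Represents {μ : Measure ℂ} (E : Submodule ℂ (Lp ℂ 2 μ)) (f : ℂ → ℂ) : Prop :=
  ∃ u ∈ E, (u : ℂ → ℂ) =ᵐ[μ] f

namespace Submodule.Represents

variable {μ : Measure ℂ} {E : Submodule ℂ (Lp ℂ 2 μ)} {f g : ℂ → ℂ}

lemma memLp (hf : E.Represents f) : MemLp f 2 μ := by
  obtain ⟨u, -, h⟩ := hf
  exact (memLp_congr_ae h).1 (Lp.memLp u)

lemma congr (hf : E.Represents f) (h : f =ᵐ[μ] g) : E.Represents g := by
  obtain ⟨u, hu, h'⟩ := hf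
  exact ⟨u, hu, h'.trans h⟩

lemma zero : E.Represents 0 := ⟨0, E.zero_mem, Lp.coeFn_zero _ _ _⟩

lemma add (hf : E.Represents f) (hg : E.Represents g) : E.Represents (f + g) := by
  obtain ⟨u, hu, h⟩ := hf
  obtain ⟨v, hv, h'⟩ := hg
  exact ⟨u + v, E.add_mem hu hv, (Lp.coeFn_add u v).trans (h.add h')⟩

lemma const_smul (hf : E.Represents f) (c : ℂ) : E.Represents (c • f) := by
  obtain ⟨u, hu, h⟩ := hf
  exact ⟨c • u, E.smul_mem c hu, (Lp.coeFn_smul c u).trans (h.const_smul c)⟩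

lemma sum {ι : Type*} (s : Finset ι) {F : ι → ℂ → ℂ} (h : ∀ i ∈ s, E.Represents (F i)) :
    E.Represents (∑ i ∈ s, F i) := by
  classical
  induction s using Finset.induction_on with
  | empty => simpa using zero
  | insert i s hi ih =>
    rw [Finset.sum_insert hi]
    exact (h i (by simp)).add (ih fun j hj => h j (by simp [hj]))

/-- A closed subspace is stable under dominated a.e. convergence. -/
lemma of_dominated (hE : IsClosed (E : Set (Lp ℂ 2 μ))) {F : ℕ → ℂ → ℂ} {b : ℂ → ℂ}
    (hF : ∀ n, E.Represents (F n)) (hb : MemLp b 2 μ)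
    (hFb : ∀ n, ∀ᵐ z ∂μ, ‖F n z‖ ≤ ‖b z‖)
    (hlim : ∀ᵐ z ∂μ, Tendsto (fun n => F n z) atTop (𝓝 (f z))) : E.Represents f := by
  have hmeas : AEStronglyMeasurable f μ :=
    aestronglyMeasurable_of_tendsto_ae atTop (fun n => (hF n).memLp.1) hlim
  have hfb : ∀ᵐ z ∂μ, ‖f z‖ ≤ ‖b z‖ := by
    filter_upwards [hlim, ae_all_iff.2 hFb] with z h1 h2
    exact le_of_tendsto h1.norm (Eventually.of_forall h2)
  have hf : MemLp f 2 μ := hb.of_le hmeas hfb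
  refine ⟨hf.toLp f, ?_, hf.coeFn_toLp⟩
  have key : Tendsto (fun n => (hF n).memLp.toLp (F n)) atTop (𝓝 (hf.toLp f)) := by
    rw [Lp.tendsto_Lp_iff_tendsto_eLpNorm'']
    have hL : Tendsto (fun n => ∫⁻ z, ‖(F n - f) z‖ₑ ^ (2 : ℝ) ∂μ) atTop (𝓝 (∫⁻ _, 0 ∂μ)) := by
      refine tendsto_lintegral_of_dominated_convergence'
        (fun z => ‖((2 : ℂ) • b) z‖ₑ ^ (2 : ℝ)) ?_ ?_ ?_ ?_
      · exact fun n => ((hF n).memLp.1.sub hmeas).enorm.pow_const _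
      · intro n
        filter_upwards [hFb n, hfb] with z h1 h2
        gcongr
        rw [enorm_le_iff_norm_le]
        simp only [Pi.sub_apply, Pi.smul_apply, smul_eq_mul, norm_mul, Complex.norm_ofNat]
        linarith [norm_sub_le (F n z) (f z)]
      · have := (hb.const_smul (2 : ℂ)).2
        have h2 := lintegral_rpow_enorm_lt_top_of_eLpNorm_lt_top two_ne_zero ENNReal.ofNat_ne_top this
        simpa using h2.ne
      · filter_upwards [hlim] with z hz
        have : Tendsto (fun n => ‖(F n - f) z‖ₑ ^ (2 : ℝ)) atTop (𝓝 (‖f z - f z‖ₑ ^ (2 : ℝ))) :=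
          ((ENNReal.continuous_rpow_const (y := 2)).tendsto _).comp
            ((hz.sub tendsto_const_nhds).enorm)
        simpa using this
    have h3 := ((ENNReal.continuous_rpow_const (y := 1 / 2)).tendsto _).comp hL
    simp only [lintegral_zero] at h3
    rw [ENNReal.zero_rpow_of_pos (by norm_num)] at h3
    refine h3.congr fun n => ?_
    rw [eLpNorm_eq_lintegral_rpow_enorm_toReal two_ne_zero ENNReal.ofNat_ne_top]
    simp
  refine hE.mem_of_tendsto key (Eventually.of_forall fun n => ?_)
  obtain ⟨u, hu, h⟩ := hF n
  have : (hF n).memLp.toLp (F n) = u := by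
    rw [← Lp.toLp_coeFn u (Lp.memLp u)]
    exact MemLp.toLp_eq_toLp_iff _ _ |>.2 h.symm
  rw [this]; exact hu

lemma pow_mul (hS : ∀ f, E.Represents f → E.Represents fun z => z * f z)
    (hf : E.Represents f) (n : ℕ) : E.Represents fun z => z ^ n * f z := by
  induction n with
  | zero => simpa using hf
  | succ n ih => simpa only [pow_succ', mul_assoc] using hS _ ih

/-- A closed shift-invariant subspace of `L²` of the circle is stable under multiplication by
the dilations `z ↦ ψ (r z)`, `0 ≤ r < 1`, of a function `ψ` holomorphic on the unit disk. -/
lemma dilation_mul (hE : IsClosed (E : Set (Lp ℂ 2 μ)))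
    (hS : ∀ f, E.Represents f → E.Represents fun z => z * f z)
    (hμ : ∀ᵐ z ∂μ, ‖z‖ = 1) {ψ : ℂ → ℂ} (hψ : DifferentiableOn ℂ ψ (ball 0 1))
    {r : ℝ} (hr0 : 0 ≤ r) (hr1 : r < 1) (hf : E.Represents f) :
    E.Represents fun z => ψ (r * z) * f z := by
  set a : ℕ → ℂ := fun n => (n.factorial : ℂ)⁻¹ * iteratedDeriv n ψ 0 * (r : ℂ) ^ n with ha
  have hsum : ∀ z : ℂ, ‖z‖ = 1 → HasSum (fun n => a n * z ^ n) (ψ (r * z)) := by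
    intro z hz
    have hmem : (r : ℂ) * z ∈ ball (0 : ℂ) 1 := by
      simpa [hz, abs_of_nonneg hr0] using hr1
    refine (Complex.hasSum_taylorSeries_on_ball hψ hmem).congr_fun ?_
    intro n
    simp only [ha, sub_zero, smul_eq_mul, mul_pow]
    ring
  have hsummable : Summable fun n => ‖a n‖ := by
    simpa using (hsum 1 (by simp)).summable.norm
  set C : ℝ := ∑' n, ‖a n‖ with hC
  refine of_dominated hE (F := fun N z => (∑ n ∈ Finset.range N, a n * z ^ n) * f z)
    (b := (C : ℂ) • f) (fun N => ?_) (hf.memLp.const_smul _) (fun N => ?_) ?_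
  · refine (sum (Finset.range N) fun n _ => (pow_mul hS hf n).const_smul (a n)).congr
      (Eventually.of_forall fun z => ?_)
    simp [Finset.sum_mul, mul_assoc]
  · filter_upwards [hμ] with z hz
    simp only [Pi.smul_apply, smul_eq_mul, norm_mul, Complex.norm_real]
    gcongr
    calc ‖∑ n ∈ Finset.range N, a n * z ^ n‖ ≤ ∑ n ∈ Finset.range N, ‖a n * z ^ n‖ :=
          norm_sum_le _ _
      _ = ∑ n ∈ Finset.range N, ‖a n‖ := by simp [hz]
      _ ≤ C := hsummable.sum_le_tsum _ fun _ _ => norm_nonneg _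
      _ ≤ ‖C‖ := Real.le_norm_self C
  · filter_upwards [hμ] with z hz
    exact (hsum z hz).tendsto_sum_nat.mul_const _

/-- A function with nonnegative real part is outer: a closed shift-invariant subspace containing
its boundary values contains the constants. -/
lemma one_of_re_nonneg (hE : IsClosed (E : Set (Lp ℂ 2 μ)))
    (hS : ∀ f, E.Represents f → E.Represents fun z => z * f z)
    (hμ : ∀ᵐ z ∂μ, ‖z‖ = 1) {F : ℂ → ℂ} (hF : DifferentiableOn ℂ F (ball 0 1))
    (hre : ∀ z, ‖z‖ ≤ 1 → 0 ≤ (F z).re) (hcont : ∀ᵐ z ∂μ, ContinuousAt F z)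
    (hne : ∀ᵐ z ∂μ, F z ≠ 0) (hFE : E.Represents F) (h1 : MemLp (fun _ => (1 : ℂ)) 2 μ) :
    E.Represents fun _ => 1 := by
  have hεre : ∀ {ε : ℝ} {z : ℂ}, ‖z‖ ≤ 1 → ε ≤ ‖F z + ε‖ := fun {ε z} hz =>
    le_trans (by simpa using hre z hz) (Complex.re_le_norm (F z + ε))
  have hεne : ∀ {ε : ℝ} {z : ℂ}, 0 < ε → ‖z‖ ≤ 1 → F z + ε ≠ 0 := fun hε hz =>
    norm_pos_iff.1 (hε.trans_le (hεre hz))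
  have hquot : ∀ ε : ℝ, 0 < ε → E.Represents fun z => (F z + ε)⁻¹ * F z := by
    intro ε hε
    have hr : ∀ n : ℕ, (0 : ℝ) ≤ 1 - 1 / ((n : ℝ) + 1) ∧ 1 - 1 / ((n : ℝ) + 1) < 1 := by
      intro n
      have : 1 / ((n : ℝ) + 1) ≤ 1 := by
        rw [div_le_one (by positivity)]
        linarith [n.cast_nonneg (α := ℝ)]
      exact ⟨by linarith, by linarith [Nat.one_div_pos_of_nat (α := ℝ) (n := n)]⟩
    have hrlim : Tendsto (fun n : ℕ => (1 - 1 / ((n : ℝ) + 1))) atTop (𝓝 1) := by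
      simpa using tendsto_one_div_add_atTop_nhds_zero_nat.const_sub (1 : ℝ)
    refine of_dominated hE
      (F := fun n z => (F (((1 - 1 / ((n : ℝ) + 1) : ℝ) : ℂ) * z) + ε)⁻¹ * F z)
      (b := ((ε⁻¹ : ℝ) : ℂ) • F) (fun n => ?_) (hFE.memLp.const_smul _) (fun n => ?_) ?_
    · refine dilation_mul (ψ := fun z => (F z + ε)⁻¹) hE hS hμ ?_ (hr n).1 (hr n).2 hFE
      refine (hF.add_const _).inv fun z hz => hεne hε ?_
      simpa using (mem_ball.1 hz).le
    · filter_upwards [hμ] with z hz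
      simp only [Pi.smul_apply, smul_eq_mul, norm_mul, norm_inv, Complex.norm_real,
        Real.norm_of_nonneg hε.le]
      gcongr
      apply hεre
      rw [norm_mul, hz, Complex.norm_real, Real.norm_of_nonneg (hr n).1, mul_one]
      exact (hr n).2.le
    · filter_upwards [hμ, hcont] with z hz hc
      refine Tendsto.mul_const _ (Tendsto.inv₀ (Tendsto.add_const _ (hc.tendsto.comp ?_))
        (hεne hε hz.le))
      simpa using (Complex.continuous_ofReal.tendsto _ |>.comp hrlim).mul_const z
  refine of_dominated hE (F := fun n z => (F z + ((1 / ((n : ℝ) + 1) : ℝ) : ℂ))⁻¹ * F z)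
    (fun n => hquot _ Nat.one_div_pos_of_nat) h1 (fun n => ?_) ?_
  · filter_upwards [hμ] with z hz
    have hε : (0 : ℝ) < 1 / ((n : ℝ) + 1) := Nat.one_div_pos_of_nat
    rw [norm_mul, norm_inv, norm_one, inv_mul_le_one₀ (norm_pos_iff.2 (hεne hε hz.le))]
    generalize 1 / ((n : ℝ) + 1) = ε at hε
    have := hre z hz.le
    rw [← sq_le_sq₀ (norm_nonneg _) (norm_nonneg _), ← Complex.normSq_eq_norm_sq,
      ← Complex.normSq_eq_norm_sq, Complex.normSq_apply, Complex.normSq_apply]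
    simp only [Complex.add_re, Complex.ofReal_re, Complex.add_im, Complex.ofReal_im, add_zero]
    nlinarith
  · filter_upwards [hne] with z hz
    have : Tendsto (fun n : ℕ => F z + ((1 / ((n : ℝ) + 1) : ℝ) : ℂ)) atTop (𝓝 (F z + (0 : ℝ))) :=
      ((Complex.continuous_ofReal.tendsto _).comp
        tendsto_one_div_add_atTop_nhds_zero_nat).const_add _
    simp only [Complex.ofReal_zero, add_zero] at this
    simpa [hz] using (this.inv₀ hz).mul_const (F z)

end Submodule.Represents

end ShiftInvariant

section Circle

open AddCircle

local instance fact_two_pi_pos : Fact (0 < 2 * Real.pi) := ⟨Real.two_pi_pos⟩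

lemma measurePreserving_toCircle_mCirc :
    MeasurePreserving (fun t : AddCircle (2 * Real.pi) => (t.toCircle : ℂ))
      haarAddCircle mCirc := by
  have hmeas : Measurable (fun t : AddCircle (2 * Real.pi) => (t.toCircle : ℂ)) :=
    (continuous_subtype_val.comp AddCircle.continuous_toCircle).measurable
  refine ⟨hmeas, ?_⟩
  have hT : ENNReal.ofReal (2 * Real.pi) ≠ 0 := by simp [Real.pi_pos]
  have h1 : (haarAddCircle : Measure (AddCircle (2 * Real.pi))) =
      (ENNReal.ofReal (2 * Real.pi))⁻¹ • volume := by
    rw [volume_eq_smul_haarAddCircle, smul_smul, ENNReal.inv_mul_cancel hT ENNReal.ofReal_ne_top,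
      one_smul]
  have h2 := AddCircle.measurePreserving_mk (2 * Real.pi) 0
  rw [zero_add] at h2
  rw [h1, Measure.map_smul, ← h2.map_eq, Measure.map_map hmeas h2.measurable, mCirc]
  congr 2
  funext θ
  have : (2 * Real.pi / (2 * Real.pi)) = 1 := div_self (by positivity)
  change ((AddCircle.toCircle (θ : AddCircle (2 * Real.pi)) : Circle) : ℂ) = _
  rw [toCircle_apply_mk, this, one_mul, Circle.coe_exp]

instance : IsProbabilityMeasure mCirc := by
  rw [← measurePreserving_toCircle_mCirc.map_eq]
  exact Measure.isProbabilityMeasure_map measurePreserving_toCircle_mCirc.aemeasurable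

lemma ae_mCirc_norm_eq_one : ∀ᵐ z ∂mCirc, ‖z‖ = 1 := by
  rw [← measurePreserving_toCircle_mCirc.map_eq,
    ae_map_iff measurePreserving_toCircle_mCirc.aemeasurable
      (measurableSet_eq_fun measurable_norm measurable_const)]
  exact Eventually.of_forall fun t => Circle.norm_coe _

lemma ae_mCirc_ne (c : ℂ) : ∀ᵐ z ∂mCirc, z ≠ c := by
  have hmeas : Measurable fun θ : ℝ => Complex.exp (θ * Complex.I) := by fun_prop
  refine Measure.ae_smul_measure ?_ _
  rw [ae_map_iff hmeas.aemeasurable (p := fun z => z ≠ c)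
    (measurableSet_singleton c).compl]
  refine ae_restrict_of_ae ?_
  have hcount : {θ : ℝ | Complex.exp (θ * Complex.I) = c}.Countable := by
    refine (countable_range fun n : ℤ =>
      ((Complex.log c + n * (2 * Real.pi * Complex.I)) / Complex.I).re).mono ?_
    rintro θ rfl
    obtain ⟨n, hn⟩ := Complex.exp_eq_exp_iff_exists_int.1
      (Complex.exp_log (Complex.exp_ne_zero (θ * Complex.I))).symm
    refine ⟨n, ?_⟩
    simp only
    rw [← hn]
    simp
  simpa [ae_iff] using hcount.measure_zero volume

/-- Trigonometric uniqueness for `L²` of the circle. -/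
lemma mCirc_eq_zero_of_fourier_eq_zero (v : Lp ℂ 2 mCirc)
    (hv : ∀ n : ℤ, ∫ ω, v ω * ω ^ (-n) ∂mCirc = 0) : v = 0 := by
  have hmp := measurePreserving_toCircle_mCirc
  have hw : Lp.compMeasurePreserving _ hmp v = 0 := by
    apply (fourierBasis (T := 2 * Real.pi)).repr.injective
    ext n
    rw [fourierBasis_repr, map_zero]
    have hmeas : AEStronglyMeasurable (fun ω => v ω * ω ^ (-n)) mCirc :=
      (Lp.aestronglyMeasurable v).mul (Measurable.aestronglyMeasurable (by fun_prop))
    have hmap := integral_map hmp.aemeasurable (f := fun ω => v ω * ω ^ (-n))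
      (by rw [hmp.map_eq]; exact hmeas)
    rw [hmp.map_eq, hv n] at hmap
    rw [fourierCoeff, lp.coeFn_zero, Pi.zero_apply, hmap]
    refine integral_congr_ae ?_
    filter_upwards [Lp.coeFn_compMeasurePreserving v hmp] with t ht
    rw [ht, fourier_apply, AddCircle.toCircle_zsmul, smul_eq_mul, mul_comm]
    simp
  have := Lp.norm_compMeasurePreserving v hmp
  rw [hw, norm_zero] at this
  exact norm_eq_zero.1 this.symm

end Circle

lemma gFun_two_eq {z : ℂ} (hz : ‖z‖ = 1) (h1 : z ≠ 1) (h2 : z ≠ -1) :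
    gFun 2 z = -(Real.log 2 - Complex.log (1 + z)) := by
  have hre : ∀ w : ℂ, ‖w‖ = 1 → w ≠ 1 → 0 < (1 - w).re := by
    intro w hw hw1
    have hle : w.re ≤ 1 := hw ▸ Complex.re_le_norm w
    rcases hle.lt_or_eq with h | h
    · simpa using h
    · refine absurd ?_ hw1
      have : w.re * w.re + w.im * w.im = 1 := by
        rw [← Complex.normSq_apply, Complex.normSq_eq_norm_sq, hw, one_pow]
      apply Complex.ext
      · simpa using h
      · rw [h] at this
        simpa using this
  have hz2 : 0 < (1 - z ^ 2).re := by
    refine hre _ (by simp [hz]) fun h => ?_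
    rcases mul_self_eq_one_iff.1 (pow_two z ▸ h) with h | h
    · exact h1 h
    · exact h2 h
  have hz1 := hre z hz h1
  have hadd : 0 < (1 + z).re := by
    have := hre (-z) (by simpa using hz) (by rintro h; exact h2 (by rw [← h, neg_neg]))
    simpa using this
  have hfac : 1 - z ^ 2 = (1 - z) * (1 + z) := by ring
  have ha := abs_lt.1 (Complex.abs_arg_lt_pi_div_two_iff.2 (Or.inl hz1))
  have hb := abs_lt.1 (Complex.abs_arg_lt_pi_div_two_iff.2 (Or.inl hadd))
  have hlog : Complex.log (1 - z ^ 2) = Complex.log (1 - z) + Complex.log (1 + z) := by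
    rw [hfac, Complex.log_mul]
    · rintro h; simp [h] at hz1
    · rintro h; simp [h] at hadd
    · exact ⟨by linarith, by linarith⟩
  rw [gFun, hlog]
  push_cast
  ring

/-- If `E` is a closed subspace of `H²` containing every `h_k`, `k ≥ 2`, and
invariant under the shift `(Sf)(ω) = ω·f(ω)`, then `E = H²`. -/
theorem shift_invariant_containing_N_eq_H2
    (E : Submodule ℂ (Lp ℂ 2 mCirc))
    (hE_closed : IsClosed (E : Set (Lp ℂ 2 mCirc)))
    (hE_sub : (E : Set (Lp ℂ 2 mCirc)) ⊆ H2)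
    (hk : ℕ → Lp ℂ 2 mCirc)
    (hk_ae : ∀ k, 2 ≤ k → (hk k : ℂ → ℂ) =ᵐ[mCirc] hFun k)
    (hk_mem : ∀ k, 2 ≤ k → hk k ∈ E)
    -- shift invariance: if `g = S f` a.e. with `f ∈ E`, then `g ∈ E`
    (hE_shift : ∀ f ∈ E, ∀ g : Lp ℂ 2 mCirc,
      (g : ℂ → ℂ) =ᵐ[mCirc] (fun ω => ω * f ω) → g ∈ E) :
    (E : Set (Lp ℂ 2 mCirc)) = H2 := by
  have hμ := ae_mCirc_norm_eq_one
  have hS : ∀ f, E.Represents f → E.Represents fun z => z * f z := by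
    rintro f ⟨u, hu, huf⟩
    have hm : MemLp (fun z => z * u z) 2 mCirc := by
      refine (Lp.memLp u).of_le
        ((Measurable.aestronglyMeasurable (by fun_prop)).mul (Lp.aestronglyMeasurable u)) ?_
      filter_upwards [hμ] with z hz
      simp [hz]
    refine ⟨hm.toLp _, hE_shift u hu _ hm.coeFn_toLp, hm.coeFn_toLp.trans ?_⟩
    filter_upwards [huf] with z hz
    rw [hz]
  have hF : E.Represents fun z => Real.log 2 - Complex.log (1 + z) := by
    have hh : E.Represents (hFun 2) := ⟨hk 2, hk_mem 2 le_rfl, hk_ae 2 le_rfl⟩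
    refine ((hS _ hh).add (hh.const_smul (-1))).congr ?_
    filter_upwards [hμ, ae_mCirc_ne 1, ae_mCirc_ne (-1)] with z hz h1 h2
    have : 1 - z ≠ 0 := sub_ne_zero.2 h1.symm
    simp only [Pi.add_apply, Pi.smul_apply, smul_eq_mul, hFun, gFun_two_eq hz h1 h2]
    field_simp
    ring
  have hslit : ∀ z : ℂ, ‖z‖ ≤ 1 → z ≠ -1 → 1 + z ∈ Complex.slitPlane := by
    intro z hz hz1
    by_contra h
    rw [Complex.mem_slitPlane_iff, not_or, not_lt, not_not] at h
    have := (abs_le.1 ((Complex.abs_re_le_norm z).trans hz)).1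
    simp only [Complex.add_re, Complex.one_re, Complex.add_im, Complex.one_im, zero_add] at h
    exact hz1 (Complex.ext (by simp; linarith) (by simp [h.2]))
  have hone : E.Represents fun _ => 1 := by
    refine Submodule.Represents.one_of_re_nonneg hE_closed hS hμ ?_ ?_ ?_ ?_ hF (memLp_const 1)
    · refine (differentiableOn_const _).sub (DifferentiableOn.clog (by fun_prop) fun z hz => ?_)
      have hz' : ‖z‖ < 1 := by simpa using hz
      refine hslit z hz'.le ?_
      rintro rfl
      simp at hz'
    · intro z hz
      rw [Complex.sub_re, Complex.ofReal_re, Complex.log_re, sub_nonneg]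
      rcases eq_or_ne (1 + z) 0 with h | h
      · simp [h, Real.log_nonneg]
      · refine Real.log_le_log (norm_pos_iff.2 h) ((norm_add_le _ _).trans ?_)
        rw [norm_one]; linarith
    · filter_upwards [hμ, ae_mCirc_ne (-1)] with z hz h2
      exact continuousAt_const.sub
        ((continuousAt_const.add continuousAt_id).clog (hslit z hz.le h2))
    · filter_upwards [ae_mCirc_ne 1, ae_mCirc_ne (-1)] with z h1 h2 h
      apply h1
      have h0 : 1 + z ≠ 0 := fun h => h2 (by linear_combination h)
      have h3 := congrArg Complex.exp (sub_eq_zero.1 h)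
      rw [Complex.exp_log h0, Complex.ofReal_log zero_le_two, Complex.exp_log (by simp)] at h3
      push_cast at h3
      linear_combination -h3
  have hpow : ∀ n : ℕ, E.Represents fun z => z ^ n := fun n => by
    simpa using hone.pow_mul hS n
  refine hE_sub.antisymm fun f hf => ?_
  have : CompleteSpace E := hE_closed.completeSpace_coe
  obtain ⟨y, hy, v, hv, rfl⟩ := E.exists_add_mem_mem_orthogonal f
  have hint : ∀ (u : Lp ℂ 2 mCirc) (n : ℤ), Integrable (fun ω => u ω * ω ^ (-n)) mCirc := by
    intro u n
    refine ((Lp.memLp u).integrable one_le_two).mono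
      ((Lp.aestronglyMeasurable u).mul (Measurable.aestronglyMeasurable (by fun_prop))) ?_
    filter_upwards [hμ] with z hz
    simp [hz]
  suffices v = 0 by rw [this, add_zero]; exact hy
  refine mCirc_eq_zero_of_fourier_eq_zero v fun n => ?_
  rcases lt_or_ge n 0 with hn | hn
  · have h1 := hf n hn
    have h2 := hE_sub hy n hn
    have h3 : ∫ ω, (y + v : Lp ℂ 2 mCirc) ω * ω ^ (-n) ∂mCirc =
        ∫ ω, (y ω * ω ^ (-n) + v ω * ω ^ (-n)) ∂mCirc := by
      refine integral_congr_ae ?_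
      filter_upwards [Lp.coeFn_add y v] with z hz
      rw [hz, Pi.add_apply, add_mul]
    rwa [h3, integral_add (hint y n) (hint v n), h2, zero_add] at h1
  · lift n to ℕ using hn
    obtain ⟨u, hu, hun⟩ := hpow n
    have h := (Submodule.mem_orthogonal E v).1 hv u hu
    rw [L2.inner_def] at h
    rw [← h]
    refine integral_congr_ae ?_
    filter_upwards [hun, hμ] with z hz hz1
    rw [RCLike.inner_apply, hz, zpow_neg, zpow_natCast, map_pow, ← inv_pow,
      Complex.inv_eq_conj hz1]
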